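/- Let n ≥ 1 be an integer and ν > 2 a real number, and let μ_τ be the Beta distribution on (0,1) with parameters (n+2)/2 and (ν-2)/2. Then the pushforward of μ_τ under the map τ ↦ √(τ/(1-τ)) is the measure on (0,∞) with density p(r) = 2 r^{n+1} (1+r²)^{-(ν+n)/2} / B((n+2)/2, (ν-2)/2) with respect to Lebesgue measure. -/

import Mathlib

open Real MeasureTheory Set

/-- The real Beta function: `B(a,b) = Γ(a)Γ(b)/Γ(a+b)`. -/
noncomputable def Beta (a b : ℝ) : ℝ := Real.Gamma a * Real.Gamma b / Real.Gamma (a + b)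

/-- The radial sampling density `p(r) = 2 r^(n+1) (1+r²)^(-(ν+n)/2) / B((n+2)/2, (ν-2)/2)`. -/
noncomputable def radialPDF (n : ℕ) (ν : ℝ) (r : ℝ) : ℝ :=
  2 * r ^ (n + 1) * (1 + r ^ 2) ^ (-((ν + n) / 2)) / Beta (((n : ℝ) + 2) / 2) ((ν - 2) / 2)

/-- The law of the radial quadrature point: the measure on `(0,∞)` with density `p`
with respect to Lebesgue measure. -/
noncomputable def radialLaw (n : ℕ) (ν : ℝ) : Measure ℝ :=
  (volume.restrict (Ioi (0 : ℝ))).withDensity fun r => ENNReal.ofReal (radialPDF n ν r)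

/-- The Beta distribution on `(0,1)` with parameters `a`, `b`: the measure with density
`τ ↦ τ^(a-1) (1-τ)^(b-1) / B(a,b)` with respect to Lebesgue measure. -/
noncomputable def betaLaw (a b : ℝ) : Measure ℝ :=
  (volume.restrict (Ioo (0 : ℝ) 1)).withDensity fun τ =>
    ENNReal.ofReal (τ ^ (a - 1) * (1 - τ) ^ (b - 1) / Beta a b)

/-- The inverse `r ↦ r² / (1 + r²)` of `τ ↦ √(τ / (1 - τ))` recovers `r`. -/
lemma sqrt_odds_sq_div_one_add_sq {r : ℝ} (hr : 0 ≤ r) :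
    √(r ^ 2 / (1 + r ^ 2) / (1 - r ^ 2 / (1 + r ^ 2))) = r := by
  have h : r ^ 2 / (1 + r ^ 2) / (1 - r ^ 2 / (1 + r ^ 2)) = r ^ 2 := by
    have h1 : 1 + r ^ 2 ≠ 0 := by positivity
    rw [one_sub_div h1, add_sub_cancel_right]
    field_simp
  rw [h, Real.sqrt_sq hr]

lemma injOn_sq_div_one_add_sq : InjOn (fun r : ℝ => r ^ 2 / (1 + r ^ 2)) (Ioi 0) :=
  LeftInvOn.injOn (f₁' := fun τ => √(τ / (1 - τ)))
    fun _ hr => sqrt_odds_sq_div_one_add_sq (le_of_lt hr)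

lemma image_sq_div_one_add_sq :
    (fun r : ℝ => r ^ 2 / (1 + r ^ 2)) '' Ioi 0 = Ioo 0 1 := by
  ext τ
  constructor
  · rintro ⟨r, hr : 0 < r, rfl⟩
    exact ⟨by positivity, (div_lt_one (by positivity)).2 (by linarith)⟩
  · rintro ⟨h0, h1⟩
    have h1' : 0 < 1 - τ := sub_pos.2 h1
    have hodds : 0 < τ / (1 - τ) := div_pos h0 h1'
    refine ⟨√(τ / (1 - τ)), Real.sqrt_pos.2 hodds, ?_⟩
    simp only [Real.sq_sqrt hodds.le]
    field_simp
    ring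

lemma hasDerivAt_sq_div_one_add_sq (r : ℝ) :
    HasDerivAt (fun r : ℝ => r ^ 2 / (1 + r ^ 2)) (2 * r / (1 + r ^ 2) ^ 2) r := by
  have hsq : HasDerivAt (fun r : ℝ => r ^ 2) (2 * r) r := by simpa using hasDerivAt_pow 2 r
  have h := hsq.div (hsq.const_add 1) (by positivity)
  convert! h using 1
  ring

/-- The unnormalised Beta density in the variable `τ = r² / (1 + r²)`, times `dτ/dr`. -/
lemma jacobian_mul_beta_kernel {r : ℝ} (hr : 0 < r) (a b : ℝ) :
    2 * r / (1 + r ^ 2) ^ 2 *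
        ((r ^ 2 / (1 + r ^ 2)) ^ (a - 1) * (1 - r ^ 2 / (1 + r ^ 2)) ^ (b - 1)) =
      2 * r ^ (2 * a - 1) * (1 + r ^ 2) ^ (-(a + b)) := by
  have hq : 0 < 1 + r ^ 2 := by positivity
  have hr' : r ^ (2 * a - 1) = r * (r ^ 2) ^ (a - 1) := by
    rw [← Real.rpow_natCast r 2, ← Real.rpow_mul hr.le, mul_comm r, ← Real.rpow_add_one hr.ne']
    congr 1
    push_cast
    ring
  have hq' : (1 + r ^ 2) ^ (-(a + b)) =
      ((1 + r ^ 2) ^ 2)⁻¹ * ((1 + r ^ 2) ^ (a - 1))⁻¹ * ((1 + r ^ 2) ^ (b - 1))⁻¹ := by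
    rw [← Real.rpow_natCast (1 + r ^ 2) 2, ← Real.rpow_neg hq.le, ← Real.rpow_neg hq.le,
      ← Real.rpow_neg hq.le, ← Real.rpow_add hq, ← Real.rpow_add hq]
    congr 1
    push_cast
    ring
  rw [one_sub_div hq.ne', add_sub_cancel_right, Real.div_rpow (by positivity) hq.le,
    Real.div_rpow zero_le_one hq.le, Real.one_rpow, hr', hq']
  ring

/-- The pushforward of the Beta distribution with parameters `(n+2)/2`, `(ν-2)/2`
under `τ ↦ √(τ/(1-τ))` is the radial law with density `p`. -/
theorem betaLaw_map_eq_radialLaw (n : ℕ) (hn : 1 ≤ n) (ν : ℝ) (hν : 2 < ν) :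
    (betaLaw (((n : ℝ) + 2) / 2) ((ν - 2) / 2)).map
        (fun τ : ℝ => Real.sqrt (τ / (1 - τ))) = radialLaw n ν := by
  set a : ℝ := ((n : ℝ) + 2) / 2 with ha
  set b : ℝ := (ν - 2) / 2 with hb
  have hmap : Measurable fun τ : ℝ => √(τ / (1 - τ)) := by fun_prop
  have hbeta : Measurable fun τ : ℝ =>
      ENNReal.ofReal (τ ^ (a - 1) * (1 - τ) ^ (b - 1) / Beta a b) := by fun_prop
  have hradial : Measurable fun r : ℝ => ENNReal.ofReal (radialPDF n ν r) := by
    unfold radialPDF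
    fun_prop
  refine Measure.ext_of_lintegral _ fun f hf => ?_
  rw [lintegral_map hf hmap, betaLaw, radialLaw,
    lintegral_withDensity_eq_lintegral_mul _ hbeta (g := fun τ => f √(τ / (1 - τ))) (hf.comp hmap),
    lintegral_withDensity_eq_lintegral_mul _ hradial hf,
    ← image_sq_div_one_add_sq,
    lintegral_image_eq_lintegral_abs_deriv_mul measurableSet_Ioi
      (fun r _ => (hasDerivAt_sq_div_one_add_sq r).hasDerivWithinAt)
      injOn_sq_div_one_add_sq]
  refine setLIntegral_congr_fun measurableSet_Ioi fun r (hr : 0 < r) => ?_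
  simp only [Pi.mul_apply, sqrt_odds_sq_div_one_add_sq hr.le]
  rw [← mul_assoc, ← ENNReal.ofReal_mul (abs_nonneg _), ← mul_div_assoc,
    abs_of_pos (by positivity), jacobian_mul_beta_kernel hr, radialPDF]
  have hpow : r ^ (2 * a - 1) = r ^ (n + 1) := by
    rw [← Real.rpow_natCast]
    congr 1
    push_cast
    rw [ha]
    ring
  have hexp : -(a + b) = -((ν + n) / 2) := by
    rw [ha, hb]
    ring
  rw [hpow, hexp]
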